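/- Let n be an odd prime and let x, y, z be pairwise relatively prime positive integers with x^n + y^n = z^n. If p is an odd prime dividing y, then ν_p(x^(p−1) − z^(p−1)) ≥ n − 1; if p is an odd prime dividing x, then ν_p(z^(p−1) − y^(p−1)) ≥ n − 1; if p is an odd prime dividing z, then ν_p(x^(p−1) − y^(p−1)) ≥ n − 1. Moreover, if in addition n ∤ xyz, then in each case the lower bound n − 1 can be improved to n. -/

import Mathlib

theorem wief_ne (n p : ℕ) (hn : n.Prime) (hp : p.Prime) (hne : p ≠ n) (a b : ℤ)
    (ha : ¬ (p : ℤ) ∣ a) (hb : ¬ (p : ℤ) ∣ b) (h : (p : ℤ) ^ n ∣ a ^ n - b ^ n) :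
    (p : ℤ) ^ n ∣ a ^ (p - 1) - b ^ (p - 1) := by
  have key : ∀ c : ℤ, ¬ (p : ℤ) ∣ c → IsUnit ((c : ℤ) : ZMod (p ^ n)) := by
    intro c hc
    have h1 : IsCoprime (p : ℤ) c := (Nat.prime_iff_prime_int.mp hp).coprime_iff_not_dvd.mpr hc
    have h2 : IsCoprime ((p : ℤ) ^ n) c := h1.pow_left
    obtain ⟨u, v, huv⟩ := h2
    have h3 := congrArg (fun t : ℤ => (t : ZMod (p ^ n))) huv
    have h0 : ((p : ZMod (p ^ n))) ^ n = 0 := by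
      have := ZMod.natCast_self (p ^ n)
      push_cast at this
      exact this
    simp only [Int.cast_add, Int.cast_mul, Int.cast_pow, Int.cast_natCast, h0, mul_zero, zero_add,
      Int.cast_one] at h3
    exact IsUnit.of_mul_eq_one_right _ h3
  obtain ⟨A, hA⟩ := key a ha
  obtain ⟨B, hB⟩ := key b hb
  have conv : ∀ k : ℕ, (p : ℤ) ^ n ∣ a ^ k - b ^ k ↔ (A / B) ^ k = 1 := by
    intro k
    have h1 : (p : ℤ) ^ n = ((p ^ n : ℕ) : ℤ) := by push_cast; rfl
    rw [h1, ← ZMod.intCast_zmod_eq_zero_iff_dvd, div_pow, div_eq_one, Units.ext_iff]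
    push_cast
    rw [hA, hB, sub_eq_zero]
  rw [conv] at h ⊢
  have h1 := orderOf_dvd_of_pow_eq_one h
  have h2 := orderOf_dvd_of_pow_eq_one (ZMod.pow_totient (A / B))
  rw [Nat.totient_prime_pow hp hn.pos] at h2
  have hc : Nat.Coprime n p := (Nat.coprime_primes hn hp).mpr (Ne.symm hne)
  have h3 : Nat.Coprime (orderOf (A / B)) (p ^ (n - 1)) :=
    Nat.Coprime.coprime_dvd_left h1 (hc.pow_right _)
  exact orderOf_dvd_iff_pow_eq_one.mp (h3.dvd_of_dvd_mul_left h2)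

theorem wief_eq (p : ℕ) (hp : p.Prime) (hodd : Odd p) (a b : ℤ)
    (ha : ¬ (p : ℤ) ∣ a) (h : (p : ℤ) ^ p ∣ a ^ p - b ^ p) :
    (p : ℤ) ^ (p - 1) ∣ a ^ (p - 1) - b ^ (p - 1) := by
  haveI := Fact.mk hp
  have h1 : (p : ℤ) ∣ a - b := by
    have h2 : (p : ℤ) ∣ a ^ p - b ^ p := (dvd_pow_self _ hp.ne_zero).trans h
    rw [← ZMod.intCast_zmod_eq_zero_iff_dvd] at h2 ⊢
    push_cast at h2 ⊢
    rwa [ZMod.pow_card, ZMod.pow_card] at h2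
  have h3 := Int.emultiplicity_pow_sub_pow hp hodd h1 ha p
  have h4 : emultiplicity p p = 1 := by
    have := (Nat.finiteMultiplicity_iff.mpr ⟨hp.ne_one, hp.pos⟩).emultiplicity_self
    exact this
  rw [h4] at h3
  have h5 := le_emultiplicity_of_pow_dvd h
  rw [h3] at h5
  refine dvd_trans (pow_dvd_of_le_emultiplicity ?_) (sub_dvd_pow_sub_pow a b (p - 1))
  have h6 : ((p - 1 : ℕ) : ℕ∞) + 1 = (p : ℕ∞) := by
    have := Nat.sub_add_cancel hp.one_le
    exact_mod_cast this
  rw [← h6] at h5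
  exact (ENat.add_le_add_iff_right (by simp)).mp h5

theorem wief_val (n p : ℕ) (hn : n.Prime) (hp : p.Prime) (hp2 : p ≠ 2) (a b : ℤ)
    (ha : ¬ (p : ℤ) ∣ a) (hb : ¬ (p : ℤ) ∣ b) (h : (p : ℤ) ^ n ∣ a ^ n - b ^ n)
    (h0 : a.natAbs ≠ b.natAbs) :
    n - 1 ≤ padicValInt p (a ^ (p - 1) - b ^ (p - 1)) ∧
    (p ≠ n → n ≤ padicValInt p (a ^ (p - 1) - b ^ (p - 1))) := by
  haveI := Fact.mk hp
  have hp1 : p - 1 ≠ 0 := by have := hp.two_le; omega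
  have hne : a ^ (p - 1) - b ^ (p - 1) ≠ 0 := by
    intro h1
    have h2 := congrArg Int.natAbs (sub_eq_zero.mp h1)
    rw [Int.natAbs_pow, Int.natAbs_pow] at h2
    exact h0 (Nat.pow_left_injective hp1 h2)
  have val : ∀ k : ℕ, (p : ℤ) ^ k ∣ a ^ (p - 1) - b ^ (p - 1) →
      k ≤ padicValInt p (a ^ (p - 1) - b ^ (p - 1)) := fun k hk =>
    ((padicValInt_dvd_iff k _).mp hk).resolve_left hne
  have main : p ≠ n → n ≤ padicValInt p (a ^ (p - 1) - b ^ (p - 1)) := fun hpn =>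
    val n (wief_ne n p hn hp hpn a b ha hb h)
  refine ⟨?_, main⟩
  by_cases hpn : p = n
  · subst hpn
    exact val _ (wief_eq p hp (hp.odd_of_ne_two hp2) a b ha h)
  · exact (Nat.sub_le _ _).trans (main hpn)

/-- Higher order Wieferich criterion for FLT. Let `n` be an odd prime and `x, y, z` be
pairwise coprime positive integers with `x^n + y^n = z^n`. Then every odd prime `p ∣ y`
satisfies `ν_p(x^(p-1) - z^(p-1)) ≥ n - 1`, every odd prime `p ∣ x` satisfies
`ν_p(z^(p-1) - y^(p-1)) ≥ n - 1`, and every odd prime `p ∣ z` satisfies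
`ν_p(x^(p-1) - y^(p-1)) ≥ n - 1`. If moreover `n ∤ x * y * z`, the bound improves to `n`. -/
theorem wieferich_criterion_flt (n : ℕ) (hn : n.Prime) (hnodd : Odd n)
    (x y z : ℕ) (hx : 0 < x) (hy : 0 < y) (hz : 0 < z)
    (hxy : Nat.Coprime x y) (hxz : Nat.Coprime x z) (hyz : Nat.Coprime y z)
    (hflt : x ^ n + y ^ n = z ^ n) :
    ((∀ p : ℕ, p.Prime → p ≠ 2 → p ∣ y →
        n - 1 ≤ padicValInt p ((x : ℤ) ^ (p - 1) - (z : ℤ) ^ (p - 1))) ∧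
      (∀ p : ℕ, p.Prime → p ≠ 2 → p ∣ x →
        n - 1 ≤ padicValInt p ((z : ℤ) ^ (p - 1) - (y : ℤ) ^ (p - 1))) ∧
      (∀ p : ℕ, p.Prime → p ≠ 2 → p ∣ z →
        n - 1 ≤ padicValInt p ((x : ℤ) ^ (p - 1) - (y : ℤ) ^ (p - 1)))) ∧
    (¬ n ∣ x * y * z →
      (∀ p : ℕ, p.Prime → p ≠ 2 → p ∣ y →
        n ≤ padicValInt p ((x : ℤ) ^ (p - 1) - (z : ℤ) ^ (p - 1))) ∧
      (∀ p : ℕ, p.Prime → p ≠ 2 → p ∣ x →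
        n ≤ padicValInt p ((z : ℤ) ^ (p - 1) - (y : ℤ) ^ (p - 1))) ∧
      (∀ p : ℕ, p.Prime → p ≠ 2 → p ∣ z →
        n ≤ padicValInt p ((x : ℤ) ^ (p - 1) - (y : ℤ) ^ (p - 1)))) := by
  have nd : ∀ {u v p : ℕ}, p.Prime → Nat.Coprime u v → p ∣ u → ¬ (p : ℤ) ∣ (v : ℤ) := by
    intro u v p hp huv hpu hpv
    exact hp.one_lt.ne' (Nat.eq_one_of_dvd_coprimes huv hpu (Int.natCast_dvd_natCast.mp hpv))
  have hfz : (x : ℤ) ^ n + (y : ℤ) ^ n = (z : ℤ) ^ n := by exact_mod_cast hflt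
  have pd : ∀ {u p : ℕ}, p ∣ u → (p : ℤ) ^ n ∣ (u : ℤ) ^ n := fun h =>
    pow_dvd_pow_of_dvd (Int.natCast_dvd_natCast.mpr h) n
  have hxz' : x ≠ z := by
    rintro rfl
    have := pow_pos hy n
    omega
  have hyz' : y ≠ z := by
    rintro rfl
    have := pow_pos hx n
    omega
  have hxy' : x ≠ y := by
    rintro rfl
    have h1 : x = 1 := by simpa using hxy
    subst h1
    have h2 : z ≠ 1 := Ne.symm hxz'
    have h3 : 2 ^ n ≤ z ^ n := Nat.pow_le_pow_left (by omega) n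
    have h4 : 2 ^ 2 ≤ 2 ^ n := Nat.pow_le_pow_right (by norm_num) hn.two_le
    simp at hflt
    omega
  have Y : ∀ p : ℕ, p.Prime → p ≠ 2 → p ∣ y → _ := fun p hp hp2 h =>
    wief_val n p hn hp hp2 x z (nd hp hxy.symm h) (nd hp hyz h)
      (by rw [← hfz, sub_add_cancel_left]; exact (pd h).neg_right) (by simpa using hxz')
  have X : ∀ p : ℕ, p.Prime → p ≠ 2 → p ∣ x → _ := fun p hp hp2 h =>
    wief_val n p hn hp hp2 z y (nd hp hxz h) (nd hp hxy h)
      (by rw [← hfz, add_sub_cancel_right]; exact pd h) (by simpa using hyz'.symm)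
  have Z : ∀ p : ℕ, p.Prime → p ≠ 2 → p ∣ z →
      n - 1 ≤ padicValInt p ((x : ℤ) ^ (p - 1) - (y : ℤ) ^ (p - 1)) ∧
      (p ≠ n → n ≤ padicValInt p ((x : ℤ) ^ (p - 1) - (y : ℤ) ^ (p - 1))) := by
    intro p hp hp2 h
    have h1 := wief_val n p hn hp hp2 x (-y) (nd hp hxz.symm h)
      (by rw [dvd_neg]; exact nd hp hyz.symm h)
      (by rw [hnodd.neg_pow, sub_neg_eq_add, hfz]; exact pd h) (by simpa using hxy')
    have he : Even (p - 1) := (hp.odd_of_ne_two hp2).tsub_odd odd_one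
    rwa [he.neg_pow] at h1
  refine ⟨⟨fun p hp hp2 h => (Y p hp hp2 h).1, fun p hp hp2 h => (X p hp hp2 h).1,
    fun p hp hp2 h => (Z p hp hp2 h).1⟩, fun hnd => ⟨fun p hp hp2 h => (Y p hp hp2 h).2 ?_,
    fun p hp hp2 h => (X p hp hp2 h).2 ?_, fun p hp hp2 h => (Z p hp hp2 h).2 ?_⟩⟩
  · rintro rfl
    exact hnd ((h.mul_left x).mul_right z)
  · rintro rfl
    exact hnd ((h.mul_right y).mul_right z)
  · rintro rfl
    exact hnd (h.mul_left _)
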